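/- Let ρ > 1 and let μ, ν ∈ P_ρ(ℝ^d). Then all Markov kernels R⋆ with μR⋆ = ν minimizing J_ρ(R) = ∫ |x − m_{R}(x)|^ρ μ(dx) have μ(dx)-a.e. equal mean maps m_{R⋆}; the pushforward μ^ρ_{P̲(ν)} := m_{R⋆}#μ is the unique probability measure η with η ≤cx ν minimizing W_ρ(μ,η)^ρ; and the probability measure μ(dx) δ_{m_{R⋆}(x)}(dy) is the unique coupling π ∈ Π(μ, μ^ρ_{P̲(ν)}) with W_ρ(μ, μ^ρ_{P̲(ν)})^ρ = ∫ |x−y|^ρ π(dx,dy). -/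

import Mathlib

open MeasureTheory ProbabilityTheory Set
open scoped ENNReal

noncomputable section

/-- `μ ≤cx ν`: convex order between measures on a normed space. -/
def ConvexOrder {E : Type*} [NormedAddCommGroup E] [NormedSpace ℝ E] [MeasurableSpace E]
    (μ ν : Measure E) : Prop :=
  (∀ φ : E → ℝ, ConvexOn ℝ univ φ → (∀ x, 0 ≤ φ x) →
      ∫⁻ x, ENNReal.ofReal (φ x) ∂μ ≤ ∫⁻ x, ENNReal.ofReal (φ x) ∂ν) ∧
  (∀ φ : E → ℝ, ConvexOn ℝ univ φ → Integrable φ (μ + ν) →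
      ∫ x, φ x ∂μ ≤ ∫ x, φ x ∂ν)

/-- `Wp ρ μ ν` is the ρ-th power `W_ρ(μ,ν)^ρ` of the ρ-Wasserstein distance. -/
def Wp {E : Type*} [NormedAddCommGroup E] [MeasurableSpace E]
    (ρ : ℝ) (μ ν : Measure E) : ℝ≥0∞ :=
  ⨅ (π : Measure (E × E)) (_ : π.map Prod.fst = μ) (_ : π.map Prod.snd = ν),
    ∫⁻ p, ENNReal.ofReal (‖p.1 - p.2‖ ^ ρ) ∂π


set_option linter.unusedSectionVars false

section aux
variable {E : Type*} [NormedAddCommGroup E] [InnerProductSpace ℝ E] [FiniteDimensional ℝ E]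
  [MeasurableSpace E] [BorelSpace E]

lemma cost_eq_eLpNorm {α F : Type*} [MeasurableSpace α] [NormedAddCommGroup F] (ρ : ℝ)
    (hρ : 1 < ρ) (P : Measure α) (f : α → F) :
    ∫⁻ x, ENNReal.ofReal (‖f x‖ ^ ρ) ∂P = eLpNorm f (ENNReal.ofReal ρ) P ^ ρ := by
  have h0 : 0 < ρ := by linarith
  rw [eLpNorm_eq_lintegral_rpow_enorm_toReal (by simp [h0]) (by simp),
    ENNReal.toReal_ofReal h0.le, ← ENNReal.rpow_mul, one_div, inv_mul_cancel₀ h0.ne',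
    ENNReal.rpow_one]
  refine lintegral_congr fun x => ?_
  rw [← ENNReal.ofReal_rpow_of_nonneg (norm_nonneg _) h0.le, ofReal_norm]

lemma convexOrder_of_nonneg (η ν : Measure E) [IsProbabilityMeasure η] [IsProbabilityMeasure ν]
    (h : ∀ φ : E → ℝ, ConvexOn ℝ univ φ → (∀ x, 0 ≤ φ x) →
      ∫⁻ x, ENNReal.ofReal (φ x) ∂η ≤ ∫⁻ x, ENNReal.ofReal (φ x) ∂ν) : ConvexOrder η ν := by
  refine ⟨h, fun φ hφ hIntg => ?_⟩
  have hη : Integrable φ η := hIntg.left_of_add_measure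
  have hν : Integrable φ ν := hIntg.right_of_add_measure
  have key : ∀ n : ℕ, ∫ x, max (φ x) (-(n:ℝ)) ∂η ≤ ∫ x, max (φ x) (-(n:ℝ)) ∂ν := by
    intro n
    have hc : ConvexOn ℝ univ (fun x => max (φ x) (-(n:ℝ)) + n) :=
      (hφ.sup (convexOn_const (-(n:ℝ)) convex_univ)).add (convexOn_const (n:ℝ) convex_univ)
    have hnn : ∀ x, 0 ≤ max (φ x) (-(n:ℝ)) + n := fun x => by
      have := le_max_right (φ x) (-(n:ℝ)); linarith
    have h1 := h _ hc hnn
    have i1 : ∀ (P : Measure E) [IsProbabilityMeasure P], Integrable φ P →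
        Integrable (fun x => max (φ x) (-(n:ℝ))) P := fun P _ hP =>
      hP.sup (integrable_const _)
    have j1 := (i1 η hη).add (integrable_const (n:ℝ))
    have j2 := (i1 ν hν).add (integrable_const (n:ℝ))
    have e1 := ofReal_integral_eq_lintegral_ofReal j1 (Filter.Eventually.of_forall hnn)
    have e2 := ofReal_integral_eq_lintegral_ofReal j2 (Filter.Eventually.of_forall hnn)
    simp only [Pi.add_apply] at e1 e2
    rw [← e1, ← e2, ENNReal.ofReal_le_ofReal_iff (integral_nonneg hnn),
      integral_add (i1 η hη) (integrable_const _), integral_add (i1 ν hν) (integrable_const _)] at h1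
    simpa using h1
  have lim : ∀ (P : Measure E) [IsProbabilityMeasure P], Integrable φ P →
      Filter.Tendsto (fun n : ℕ => ∫ x, max (φ x) (-(n:ℝ)) ∂P) Filter.atTop
        (nhds (∫ x, φ x ∂P)) := by
    intro P _ hP
    refine tendsto_integral_of_dominated_convergence (fun x => |φ x|)
      (fun n => (hP.sup (integrable_const (-(n:ℝ)))).aestronglyMeasurable) hP.abs ?_ ?_
    · intro n
      refine Filter.Eventually.of_forall fun x => ?_
      rw [Real.norm_eq_abs]
      have hn : (0:ℝ) ≤ n := n.cast_nonneg
      rcases le_total (φ x) (-(n:ℝ)) with h | h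
      · rw [max_eq_right h, abs_neg, abs_of_nonneg hn, abs_of_nonpos (by linarith)]; linarith
      · rw [max_eq_left h]
    · refine Filter.Eventually.of_forall fun x => ?_
      obtain ⟨N, hN⟩ := exists_nat_ge (-(φ x))
      refine tendsto_const_nhds.congr' ?_
      filter_upwards [Filter.eventually_ge_atTop N] with n hn
      rw [max_eq_left]
      have : (N:ℝ) ≤ n := by exact_mod_cast hn
      linarith
  exact le_of_tendsto_of_tendsto' (lim η hη) (lim ν hν) key

lemma jensen_lintegral {Ω : Type*} [MeasurableSpace Ω] (P : Measure Ω) [IsProbabilityMeasure P]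
    (f : Ω → E) (hf : Integrable f P) (φ : E → ℝ) (hφ : ConvexOn ℝ univ φ) (h0 : ∀ x, 0 ≤ φ x) :
    ENNReal.ofReal (φ (∫ x, f x ∂P)) ≤ ∫⁻ x, ENNReal.ofReal (φ (f x)) ∂P := by
  have hc : Continuous φ := hφ.locallyLipschitz.continuous
  by_cases ht : ∫⁻ x, ENNReal.ofReal (φ (f x)) ∂P = ∞
  · rw [ht]; exact le_top
  have hm : AEStronglyMeasurable (φ ∘ f) P := hc.comp_aestronglyMeasurable hf.1
  have hi : Integrable (φ ∘ f) P := by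
    refine ⟨hm, ?_⟩
    refine (hasFiniteIntegral_iff_ofReal (f := φ ∘ f)
      (Filter.Eventually.of_forall fun x => h0 _)).2 ?_
    exact lt_top_iff_ne_top.2 ht
  have := hφ.map_integral_le hc.continuousOn isClosed_univ (by simp) hf hi
  have e := ofReal_integral_eq_lintegral_ofReal hi (Filter.Eventually.of_forall fun x => h0 _)
  simp only [Function.comp_apply] at e
  rw [← e]
  exact ENNReal.ofReal_le_ofReal this

lemma integrable_id_of_rpow (ρ : ℝ) (hρ : 1 < ρ) (P : Measure E) [IsProbabilityMeasure P]
    (h : Integrable (fun x => ‖x‖ ^ ρ) P) : MemLp (fun x : E => x) (ENNReal.ofReal ρ) P := by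
  have h0 : 0 < ρ := by linarith
  rw [← integrable_norm_rpow_iff (by fun_prop) (by simp [h0]) (by simp),
    ENNReal.toReal_ofReal h0.le]
  exact h

lemma measurable_mean (R : Kernel E E) : Measurable (fun x => ∫ y, y ∂(R x)) :=
  (StronglyMeasurable.integral_kernel (f := fun y : E => y) stronglyMeasurable_id).measurable

lemma mean_convexOrder (μ ν : Measure E) [IsProbabilityMeasure μ] [IsProbabilityMeasure ν]
    (hν : Integrable (fun x : E => x) ν) (R : Kernel E E) [IsMarkovKernel R]
    (hR : μ.bind ⇑R = ν) : ConvexOrder (μ.map fun x => ∫ y, y ∂(R x)) ν := by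
  have hm := measurable_mean R
  have : IsProbabilityMeasure (μ.map fun x => ∫ y, y ∂(R x)) :=
    Measure.isProbabilityMeasure_map hm.aemeasurable
  apply convexOrder_of_nonneg
  intro φ hφ h0
  have hc : Continuous φ := hφ.locallyLipschitz.continuous
  have hcm : Measurable (fun x => ENNReal.ofReal (φ x)) := by fun_prop
  rw [lintegral_map hcm hm]
  conv_rhs => rw [← hR]
  rw [Measure.lintegral_bind R.measurable.aemeasurable hcm.aemeasurable]
  have hi : ∀ᵐ x ∂μ, Integrable (fun y : E => y) (R x) := by
    have h1 : ∫⁻ y, ‖y‖ₑ ∂ν < ∞ := hν.2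
    rw [← hR, Measure.lintegral_bind R.measurable.aemeasurable (by fun_prop)] at h1
    filter_upwards [ae_lt_top (Measurable.lintegral_kernel (by fun_prop)) h1.ne] with x hx
    exact ⟨by fun_prop, hx⟩
  refine lintegral_mono_ae ?_
  filter_upwards [hi] with x hx
  exact jensen_lintegral (R x) _ hx φ hφ h0

lemma convexOn_norm_rpow (ρ : ℝ) (hρ : 1 < ρ) : ConvexOn ℝ univ (fun x : E => ‖x‖ ^ ρ) := by
  refine ⟨convex_univ, fun x _ y _ a b ha hb hab => ?_⟩
  calc ‖a • x + b • y‖ ^ ρ ≤ (a • ‖x‖ + b • ‖y‖) ^ ρ := by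
        refine Real.rpow_le_rpow (norm_nonneg _) ?_ (by linarith)
        refine (norm_add_le _ _).trans ?_
        simp [norm_smul, abs_of_nonneg ha, abs_of_nonneg hb]
    _ ≤ _ := (convexOn_rpow hρ.le).2 (norm_nonneg x) (norm_nonneg y) ha hb hab

lemma strict_mid (ρ : ℝ) (hρ : 1 < ρ) (u v : E) (h : u ≠ v) :
    ‖(1/2:ℝ) • (u + v)‖ ^ ρ < (‖u‖ ^ ρ + ‖v‖ ^ ρ) / 2 := by
  have h0 : 0 < ρ := by linarith
  have e1 : ‖(1/2:ℝ) • (u + v)‖ ≤ (1/2:ℝ) * ‖u‖ + (1/2) * ‖v‖ := by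
    rw [norm_smul]; have := norm_add_le u v
    norm_num; linarith
  rcases eq_or_ne ‖u‖ ‖v‖ with heq | hne
  · have : ‖(1/2:ℝ) • (u + v)‖ < ‖u‖ := by
      have := norm_combo_lt_of_ne (E := E) (le_refl ‖u‖) heq.ge h (a := 1/2) (b := 1/2)
        (by norm_num) (by norm_num) (by norm_num)
      rwa [smul_add]
    have := Real.rpow_lt_rpow (norm_nonneg _) this h0
    rw [← heq]; linarith
  · have h2 := (strictConvexOn_rpow hρ).2 (norm_nonneg u) (norm_nonneg v) hne
      (show (0:ℝ) < 1/2 by norm_num) (show (0:ℝ) < 1/2 by norm_num) (by norm_num)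
    simp only [smul_eq_mul] at h2
    have := Real.rpow_le_rpow (norm_nonneg _) e1 h0.le
    linarith

/-- modulus of strict convexity on bounded sets -/
lemma exists_modulus (ρ : ℝ) (hρ : 1 < ρ) (M δ : ℝ) (hδ : 0 < δ) :
    ∃ κ > 0, ∀ u v : E, ‖u‖ ≤ M → ‖v‖ ≤ M → δ ≤ ‖u - v‖ →
      κ + ‖(1/2:ℝ) • (u + v)‖ ^ ρ ≤ (‖u‖ ^ ρ + ‖v‖ ^ ρ) / 2 := by
  have h0 : 0 ≤ ρ := by linarith
  let K : Set (E × E) := (Metric.closedBall 0 M ×ˢ Metric.closedBall 0 M) ∩ {p | δ ≤ ‖p.1 - p.2‖}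
  have hK : IsCompact K := ((isCompact_closedBall _ _).prod (isCompact_closedBall _ _)).inter_right
    (isClosed_le continuous_const (by fun_prop))
  let D : E × E → ℝ := fun p => (‖p.1‖ ^ ρ + ‖p.2‖ ^ ρ) / 2 - ‖(1/2:ℝ) • (p.1 + p.2)‖ ^ ρ
  have hD : Continuous D := by
    have : Continuous fun t : ℝ => t ^ ρ := Real.continuous_rpow_const h0
    have c1 : Continuous fun p : E × E => ‖p.1‖ ^ ρ := this.comp (by fun_prop)
    have c2 : Continuous fun p : E × E => ‖p.2‖ ^ ρ := this.comp (by fun_prop)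
    have c3 : Continuous fun p : E × E => ‖(1/2:ℝ) • (p.1 + p.2)‖ ^ ρ := this.comp (by fun_prop)
    exact ((c1.add c2).div_const 2).sub c3
  rcases K.eq_empty_or_nonempty with he | hne
  · refine ⟨1, one_pos, fun u v hu hv huv => ?_⟩
    have : (u, v) ∈ K := ⟨⟨by simpa using hu, by simpa using hv⟩, huv⟩
    rw [he] at this; exact this.elim
  · obtain ⟨p, hp, hmin⟩ := hK.exists_isMinOn hne hD.continuousOn
    refine ⟨D p, ?_, fun u v hu hv huv => ?_⟩
    · have hne : p.1 ≠ p.2 := by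
        intro h
        have := hp.2
        simp only [mem_ofPred_eq, h, sub_self, norm_zero] at this
        linarith
      have := strict_mid ρ hρ p.1 p.2 hne
      simp only [D]; linarith
    · have : (u, v) ∈ K := ⟨⟨by simpa using hu, by simpa using hv⟩, huv⟩
      have := hmin this
      simp only [mem_ofPred_eq, D] at this ⊢
      linarith

lemma mid_convexOrder (μ ν : Measure E) [IsProbabilityMeasure μ] [IsProbabilityMeasure ν]
    (m : E → E) (hm : Measurable m) (hproj : ConvexOrder (μ.map m) ν)
    (π' : Measure (E × E)) (h1 : π'.map Prod.fst = μ) (h2 : ConvexOrder (π'.map Prod.snd) ν)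
    [IsProbabilityMeasure π'] :
    ConvexOrder (π'.map fun p => (1/2:ℝ) • (m p.1 + p.2)) ν := by
  have hmm : Measurable fun p : E × E => (1/2:ℝ) • (m p.1 + p.2) := by fun_prop
  have : IsProbabilityMeasure (π'.map fun p => (1/2:ℝ) • (m p.1 + p.2)) :=
    Measure.isProbabilityMeasure_map hmm.aemeasurable
  apply convexOrder_of_nonneg
  intro φ hφ h0
  have hc : Continuous φ := hφ.locallyLipschitz.continuous
  have hcm : Measurable (fun x => ENNReal.ofReal (φ x)) := by fun_prop
  rw [lintegral_map hcm hmm]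
  have a1 := hproj.1 φ hφ h0
  have a2 := h2.1 φ hφ h0
  rw [lintegral_map hcm hm, ← h1, lintegral_map (by fun_prop) measurable_fst] at a1
  rw [lintegral_map hcm measurable_snd] at a2
  set I := ∫⁻ x, ENNReal.ofReal (φ x) ∂ν
  calc ∫⁻ p, ENNReal.ofReal (φ ((1/2:ℝ) • (m p.1 + p.2))) ∂π'
      ≤ ∫⁻ p, (ENNReal.ofReal (1/2) * ENNReal.ofReal (φ (m p.1)) +
          ENNReal.ofReal (1/2) * ENNReal.ofReal (φ p.2)) ∂π' := by
        refine lintegral_mono fun p => ?_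
        rw [← ENNReal.ofReal_mul (by norm_num), ← ENNReal.ofReal_mul (by norm_num),
          ← ENNReal.ofReal_add (by have := h0 (m p.1); positivity) (by have := h0 p.2; positivity)]
        apply ENNReal.ofReal_le_ofReal
        rw [smul_add]
        exact hφ.2 (mem_univ _) (mem_univ _) (by norm_num) (by norm_num) (by norm_num)
    _ = ENNReal.ofReal (1/2) * ∫⁻ p, ENNReal.ofReal (φ (m p.1)) ∂π' +
          ENNReal.ofReal (1/2) * ∫⁻ p, ENNReal.ofReal (φ p.2) ∂π' := by
        rw [lintegral_add_left (by fun_prop), lintegral_const_mul _ (by fun_prop),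
          lintegral_const_mul _ (by fun_prop)]
    _ ≤ ENNReal.ofReal (1/2) * I + ENNReal.ofReal (1/2) * I := by gcongr
    _ = I := by
        rw [← add_mul, ← ENNReal.ofReal_add (by norm_num) (by norm_num)]; norm_num

lemma stability (ρ : ℝ) (hρ : 1 < ρ)
    (μ ν : Measure E) [IsProbabilityMeasure μ] [IsProbabilityMeasure ν]
    (m : E → E) (hm : Measurable m) (hproj : ConvexOrder (μ.map m) ν)
    (W : ℝ≥0∞) (hW : W ≠ ∞) (hmW : ∫⁻ x, ENNReal.ofReal (‖x - m x‖ ^ ρ) ∂μ ≤ W)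
    (hmin : ∀ π' : Measure (E × E), π'.map Prod.fst = μ → ConvexOrder (π'.map Prod.snd) ν →
      W ≤ ∫⁻ p, ENNReal.ofReal (‖p.1 - p.2‖ ^ ρ) ∂π')
    (δ : ℝ) (hδ : 0 < δ) :
    ∃ κ > 0, ∀ π' : Measure (E × E), π'.map Prod.fst = μ → ConvexOrder (π'.map Prod.snd) ν →
      ∫⁻ p, ENNReal.ofReal (‖p.1 - p.2‖ ^ ρ) ∂π' ≤ W + ENNReal.ofReal κ →
      π' {p | δ ≤ ‖p.2 - m p.1‖} ≤ ENNReal.ofReal δ := by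
  have h0 : 0 < ρ := by linarith
  set w := W.toReal with hw
  have hwn : 0 ≤ w := ENNReal.toReal_nonneg
  have hWw : W = ENNReal.ofReal w := (ENNReal.ofReal_toReal hW).symm
  set M := (3 * (w + 1) / δ) ^ (1/ρ) with hM
  have hMρ : M ^ ρ = 3 * (w + 1) / δ := by
    rw [hM, ← Real.rpow_mul (by positivity), one_div, inv_mul_cancel₀ h0.ne', Real.rpow_one]
  have hM0 : 0 ≤ M := by positivity
  obtain ⟨κ₀, hκ₀, hmod⟩ := exists_modulus (E := E) ρ hρ M δ hδ
  refine ⟨min 1 (κ₀ * (δ / 3)), by positivity, fun π' h1 h2 hcost => ?_⟩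
  set κ := min 1 (κ₀ * (δ / 3)) with hκ
  have hP : IsProbabilityMeasure π' := by
    constructor
    have : (π'.map Prod.fst) univ = 1 := by rw [h1]; simp
    rwa [Measure.map_apply measurable_fst MeasurableSet.univ] at this
  let U : E × E → ℝ := fun p => ‖p.1 - m p.1‖ ^ ρ
  let V : E × E → ℝ := fun p => ‖p.1 - p.2‖ ^ ρ
  let T : E × E → ℝ := fun p => ‖p.1 - (1/2:ℝ) • (m p.1 + p.2)‖ ^ ρ
  have hU : Measurable U := by fun_prop
  have hV : Measurable V := by fun_prop
  have hT : Measurable T := by fun_prop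
  have hUn : ∀ p, 0 ≤ U p := fun p => by positivity
  have hVn : ∀ p, 0 ≤ V p := fun p => by positivity
  have hTn : ∀ p, 0 ≤ T p := fun p => by positivity
  have hmid : ∀ p : E × E, p.1 - (1/2:ℝ) • (m p.1 + p.2) =
      (1/2:ℝ) • ((p.1 - m p.1) + (p.1 - p.2)) := fun p => by module
  have hTle : ∀ p, T p ≤ (U p + V p) / 2 := fun p => by
    simp only [T, U, V, hmid]
    rcases eq_or_ne (p.1 - m p.1) (p.1 - p.2) with h | h
    · rw [← h, ← two_smul ℝ, smul_smul]; norm_num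
    · exact (strict_mid ρ hρ _ _ h).le
  have iU : ∫⁻ p, ENNReal.ofReal (U p) ∂π' ≤ W := by
    rw [← h1, lintegral_map (by fun_prop) measurable_fst] at hmW
    exact hmW
  have iV : ∫⁻ p, ENNReal.ofReal (V p) ∂π' ≤ W + ENNReal.ofReal κ := hcost
  have iT : W ≤ ∫⁻ p, ENNReal.ofReal (T p) ∂π' := by
    have hmm : Measurable fun p : E × E => (p.1, (1/2:ℝ) • (m p.1 + p.2)) := by fun_prop
    have := hmin (π'.map fun p => (p.1, (1/2:ℝ) • (m p.1 + p.2))) ?_ ?_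
    · rwa [lintegral_map (by fun_prop) hmm] at this
    · rw [Measure.map_map measurable_fst hmm]; exact h1
    · rw [Measure.map_map measurable_snd hmm]
      exact mid_convexOrder μ ν m hm hproj π' h1 h2
  have iD : ∫⁻ p, ENNReal.ofReal ((U p + V p) / 2 - T p) ∂π' ≤ ENNReal.ofReal κ := by
    have e : ∫⁻ p, ENNReal.ofReal ((U p + V p) / 2 - T p) ∂π' + ∫⁻ p, ENNReal.ofReal (T p) ∂π'
        ≤ W + ENNReal.ofReal κ := by
      rw [← lintegral_add_right _ (by fun_prop)]
      calc _ = ∫⁻ p, (ENNReal.ofReal (1/2) * ENNReal.ofReal (U p) +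
                ENNReal.ofReal (1/2) * ENNReal.ofReal (V p)) ∂π' := by
            refine lintegral_congr fun p => ?_
            have := hUn p
            have := hVn p
            rw [← ENNReal.ofReal_add (by linarith [hTle p]) (hTn p),
              ← ENNReal.ofReal_mul (by norm_num), ← ENNReal.ofReal_mul (by norm_num),
              ← ENNReal.ofReal_add (by positivity) (by positivity)]
            congr 1; ring
        _ = ENNReal.ofReal (1/2) * ∫⁻ p, ENNReal.ofReal (U p) ∂π' +
              ENNReal.ofReal (1/2) * ∫⁻ p, ENNReal.ofReal (V p) ∂π' := by
            rw [lintegral_add_left (by fun_prop), lintegral_const_mul _ (by fun_prop),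
              lintegral_const_mul _ (by fun_prop)]
        _ ≤ ENNReal.ofReal (1/2) * (W + ENNReal.ofReal κ) +
              ENNReal.ofReal (1/2) * (W + ENNReal.ofReal κ) := by
            gcongr
            exact iU.trans le_self_add
        _ = _ := by
            rw [← add_mul, ← ENNReal.ofReal_add (by norm_num) (by norm_num)]; norm_num
    have e2 : W + ∫⁻ p, ENNReal.ofReal ((U p + V p) / 2 - T p) ∂π' ≤ W + ENNReal.ofReal κ := by
      refine le_trans ?_ e
      rw [add_comm]; gcongr
    exact (ENNReal.add_le_add_iff_left hW).1 e2
  -- Markov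
  have markov : ∀ (f : E × E → ℝ) (_ : Measurable f) (c : ℝ) (_ : 0 < c),
      ∫⁻ p, ENNReal.ofReal (f p) ∂π' ≤ ENNReal.ofReal (c * (δ / 3)) →
      π' {p | c ≤ f p} ≤ ENNReal.ofReal (δ / 3) := by
    intro f hf c hc hle
    have := mul_meas_ge_le_lintegral (μ := π') (f := fun p => ENNReal.ofReal (f p))
      (by fun_prop) (ENNReal.ofReal c)
    have h3 := this.trans hle
    rw [ENNReal.ofReal_mul hc.le] at h3
    have h4 := (ENNReal.mul_le_mul_iff_right (by simpa using hc) (by simp)).1 h3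
    refine le_trans (measure_mono ?_) h4
    intro p hp
    exact ENNReal.ofReal_le_ofReal hp
  have hMW : M ^ ρ * (δ / 3) = w + 1 := by rw [hMρ]; field_simp
  have hMpos : 0 < M ^ ρ := by rw [hMρ]; positivity
  have m1 := markov _ (by fun_prop) κ₀ hκ₀ (iD.trans (ENNReal.ofReal_le_ofReal (min_le_right _ _)))
  have m2 := markov U hU (M ^ ρ) hMpos (iU.trans (by
    rw [hMW, hWw]; exact ENNReal.ofReal_le_ofReal (by linarith)))
  have m3 := markov V hV (M ^ ρ) hMpos (iV.trans (by
    rw [hMW, hWw, ← ENNReal.ofReal_add hwn (by positivity)]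
    exact ENNReal.ofReal_le_ofReal (by linarith [min_le_left 1 (κ₀ * (δ / 3))])))
  have hsub : {p : E × E | δ ≤ ‖p.2 - m p.1‖} ⊆
      {p | κ₀ ≤ (U p + V p) / 2 - T p} ∪ ({p | M ^ ρ ≤ U p} ∪ {p | M ^ ρ ≤ V p}) := by
    intro p hp
    by_cases hu : M ^ ρ ≤ U p
    · exact Or.inr (Or.inl hu)
    by_cases hv : M ^ ρ ≤ V p
    · exact Or.inr (Or.inr hv)
    left
    have hu' : ‖p.1 - m p.1‖ ≤ M := by
      by_contra hlt
      exact hu (Real.rpow_le_rpow hM0 (not_le.1 hlt).le h0.le)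
    have hv' : ‖p.1 - p.2‖ ≤ M := by
      by_contra hlt
      exact hv (Real.rpow_le_rpow hM0 (not_le.1 hlt).le h0.le)
    have hd : δ ≤ ‖(p.1 - m p.1) - (p.1 - p.2)‖ := by
      have : (p.1 - m p.1) - (p.1 - p.2) = p.2 - m p.1 := by abel
      rw [this]; exact hp
    have := hmod _ _ hu' hv' hd
    show κ₀ ≤ (U p + V p) / 2 - T p
    simp only [T, hmid, U, V]
    linarith
  calc _ ≤ _ := measure_mono hsub
    _ ≤ ENNReal.ofReal (δ/3) + (ENNReal.ofReal (δ/3) + ENNReal.ofReal (δ/3)) :=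
      (measure_union_le _ _).trans (add_le_add m1 ((measure_union_le _ _).trans (add_le_add m2 m3)))
    _ = ENNReal.ofReal δ := by
      rw [← ENNReal.ofReal_add (by positivity) (by positivity),
        ← ENNReal.ofReal_add (by positivity) (by positivity)]
      congr 1; ring

lemma strassen_closure {I : Type*} [Fintype I] [Nonempty I] [DecidableEq I] (ν : Measure E)
    [IsProbabilityMeasure ν]
    (hν : Integrable (fun y : E => y) ν) (a : I → ℝ) (z : I → E)
    (h : ∀ (b : I → ℝ) (l : I → E →L[ℝ] ℝ), ∑ i, (b i * a i + l i (z i)) ≤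
      ∫ y, Finset.univ.sup' Finset.univ_nonempty (fun i => b i + l i y) ∂ν)
    (ε : ℝ) (hε : 0 < ε) :
    ∃ w : I → E → ℝ, (∀ i, Measurable (w i)) ∧ (∀ i y, 0 ≤ w i y) ∧ (∀ y, ∑ i, w i y = 1) ∧
      (∀ i, |∫ y, w i y ∂ν - a i| < ε) ∧ (∀ i, ‖∫ y, w i y • y ∂ν - z i‖ < ε) := by
  let K : Set (I → ℝ × E) := {q | ∃ w : I → E → ℝ, (∀ i, Measurable (w i)) ∧
    (∀ i y, 0 ≤ w i y) ∧ (∀ y, ∑ i, w i y = 1) ∧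
    q = fun i => (∫ y, w i y ∂ν, ∫ y, w i y • y ∂ν)}
  have hle1 : ∀ w : I → E → ℝ, (∀ i y, 0 ≤ w i y) → (∀ y, ∑ i, w i y = 1) →
      ∀ i y, w i y ≤ 1 := fun w h0 h1 i y => by
    rw [← h1 y]; exact Finset.single_le_sum (f := fun i => w i y) (fun j _ => h0 j y) (Finset.mem_univ i)
  have hIntg : ∀ w : I → E → ℝ, (∀ i, Measurable (w i)) → (∀ i y, 0 ≤ w i y) →
      (∀ y, ∑ i, w i y = 1) → ∀ i, Integrable (w i) ν ∧ Integrable (fun y => w i y • y) ν := by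
    intro w hm h0 h1 i
    have hb : ∀ y, ‖w i y‖ ≤ 1 := fun y => by
      rw [Real.norm_eq_abs, abs_of_nonneg (h0 i y)]; exact hle1 w h0 h1 i y
    refine ⟨Integrable.of_bound (hm i).aestronglyMeasurable 1 (Filter.Eventually.of_forall hb), ?_⟩
    exact hν.bdd_smul 1 (hm i).aestronglyMeasurable (Filter.Eventually.of_forall hb)
  have hK : Convex ℝ K := by
    rintro q ⟨w, hm, h0, h1, rfl⟩ q' ⟨w', hm', h0', h1', rfl⟩ s t hs ht hst
    refine ⟨fun i y => s * w i y + t * w' i y, fun i => by have := hm i; have := hm' i; fun_prop,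
      fun i y => add_nonneg (mul_nonneg hs (h0 i y)) (mul_nonneg ht (h0' i y)), fun y => ?_, ?_⟩
    · rw [Finset.sum_add_distrib, ← Finset.mul_sum, ← Finset.mul_sum, h1, h1']; simpa using hst
    · funext i
      have i1 := hIntg w hm h0 h1 i
      have i2 := hIntg w' hm' h0' h1' i
      have e1 : ∫ y, (s * w i y + t * w' i y) ∂ν = s * ∫ y, w i y ∂ν + t * ∫ y, w' i y ∂ν := by
        rw [integral_add (i1.1.const_mul s) (i2.1.const_mul t), integral_const_mul,
          integral_const_mul]
      have e2 : ∫ y, (s * w i y + t * w' i y) • y ∂ν =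
          s • ∫ y, w i y • y ∂ν + t • ∫ y, w' i y • y ∂ν := by
        rw [← integral_smul, ← integral_smul, ← integral_add
          (show Integrable (fun y => s • w i y • y) ν from i1.2.smul s)
          (show Integrable (fun y => t • w' i y • y) ν from i2.2.smul t)]
        refine integral_congr_ae (Filter.Eventually.of_forall fun y => ?_)
        simp only [add_smul, mul_smul]
      rw [e1, e2]; rfl
  have hmem : (fun i => (a i, z i)) ∈ closure K := by
    by_contra hnot
    obtain ⟨f, u, hf1, hf2⟩ := geometric_hahn_banach_closed_point hK.closure isClosed_closure hnot
    let b : I → ℝ := fun i => f (Pi.single i ((1:ℝ), (0:E)))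
    let l : I → E →L[ℝ] ℝ := fun i =>
      f.comp ((ContinuousLinearMap.single ℝ (fun _ : I => ℝ × E) i).comp
        (ContinuousLinearMap.inr ℝ ℝ E))
    have hfq : ∀ q : I → ℝ × E, f q = ∑ i, (b i * (q i).1 + l i (q i).2) := by
      intro q
      conv_lhs => rw [← Finset.univ_sum_single q]
      rw [map_sum]
      refine Finset.sum_congr rfl fun i _ => ?_
      have : (Pi.single i (q i) : I → ℝ × E) = (q i).1 • (Pi.single i ((1:ℝ), (0:E)) : I → ℝ × E) +
          (Pi.single i ((0:ℝ), (q i).2) : I → ℝ × E) := by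
        rw [← Pi.single_smul, ← Pi.single_add]; simp
      rw [this, map_add, map_smul, smul_eq_mul, mul_comm]
      rfl
    have hfp := h b l
    rw [hfq] at hf2
    set S : E → ℝ := fun y => Finset.univ.sup' Finset.univ_nonempty (fun i => b i + l i y) with hS
    have hSm : Measurable S := by
      have : Continuous S := by
        rw [hS]
        exact Continuous.finset_sup'_apply _ (fun i _ => by fun_prop)
      exact this.measurable
    let A : I → Set E := fun i => {y | b i + l i y = S y}
    have hA : ∀ i, MeasurableSet (A i) := fun i => measurableSet_eq_fun (by fun_prop) hSm
    let N : E → ℝ := fun y => ∑ j, (A j).indicator (fun _ => (1:ℝ)) y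
    have hNpos : ∀ y, 0 < N y := by
      intro y
      obtain ⟨i, _, hi⟩ := Finset.exists_mem_eq_sup' (s := (Finset.univ : Finset I))
        Finset.univ_nonempty (fun i => b i + l i y)
      have hyi : y ∈ A i := hi.symm
      refine lt_of_lt_of_le one_pos ?_
      calc (1:ℝ) = (A i).indicator (fun _ => (1:ℝ)) y := by simp [hyi]
        _ ≤ N y := Finset.single_le_sum (f := fun j => (A j).indicator (fun _ => (1:ℝ)) y)
            (fun j _ => indicator_nonneg (fun _ _ => zero_le_one) _) (Finset.mem_univ i)
    have hind : ∀ i, Measurable ((A i).indicator (fun _ : E => (1:ℝ))) := fun i =>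
      measurable_const.indicator (hA i)
    have hNm : Measurable N := Finset.measurable_sum _ (fun i _ => hind i)
    let w : I → E → ℝ := fun i y => (A i).indicator (fun _ => (1:ℝ)) y / N y
    have hwm : ∀ i, Measurable (w i) := fun i => (hind i).div hNm
    have hw0 : ∀ i y, 0 ≤ w i y := fun i y =>
      div_nonneg (indicator_nonneg (fun _ _ => zero_le_one) _) (hNpos y).le
    have hw1 : ∀ y, ∑ i, w i y = 1 := fun y => by
      simp only [w]; rw [← Finset.sum_div]; exact div_self (hNpos y).ne'
    have hq := hf1 _ (subset_closure ⟨w, hwm, hw0, hw1, rfl⟩)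
    rw [hfq] at hq
    have hwS : ∀ y, ∑ i, (b i * w i y + l i (w i y • y)) = S y := by
      intro y
      have : ∀ i, b i * w i y + l i (w i y • y) = w i y * S y := by
        intro i
        by_cases hy : y ∈ A i
        · have : b i + l i y = S y := hy
          rw [map_smul, smul_eq_mul, ← this]; ring
        · simp [w, hy]
      rw [Finset.sum_congr rfl (fun i _ => this i), ← Finset.sum_mul, hw1, one_mul]
    have hI : ∑ i, (b i * ∫ y, w i y ∂ν + l i (∫ y, w i y • y ∂ν)) = ∫ y, S y ∂ν := by
      rw [← integral_congr_ae (Filter.Eventually.of_forall hwS), integral_finsetSum]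
      · refine Finset.sum_congr rfl fun i _ => ?_
        have ii := hIntg w hwm hw0 hw1 i
        rw [integral_add (ii.1.const_mul _) ((l i).integrable_comp ii.2), integral_const_mul,
          ContinuousLinearMap.integral_comp_comm _ ii.2]
      · intro i _
        have ii := hIntg w hwm hw0 hw1 i
        exact (ii.1.const_mul _).add ((l i).integrable_comp ii.2)
    simp only at hq hf2
    rw [hI] at hq
    linarith
  obtain ⟨q, ⟨w, hm, h0, h1, rfl⟩, hd⟩ := Metric.mem_closure_iff.1 hmem ε hε
  refine ⟨w, hm, h0, h1, fun i => ?_, fun i => ?_⟩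
  · have := (dist_pi_lt_iff hε).1 hd i
    rw [Prod.dist_eq, dist_comm] at this
    exact (le_max_left _ _).trans_lt this
  · have := (dist_pi_lt_iff hε).1 hd i
    rw [Prod.dist_eq, dist_comm (z i), dist_eq_norm] at this
    refine lt_of_le_of_lt ?_ this
    rw [dist_eq_norm]
    exact le_max_right _ _

lemma strassen_finite {I : Type*} [Fintype I] [Nonempty I] [DecidableEq I] (ν : Measure E)
    [IsProbabilityMeasure ν]
    (hν : Integrable (fun y : E => y) ν) (a : I → ℝ) (ha : ∀ i, 0 < a i) (ha1 : ∑ i, a i = 1)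
    (z : I → E)
    (h : ∀ (b : I → ℝ) (l : I → E →L[ℝ] ℝ), ∑ i, (b i * a i + l i (z i)) ≤
      ∫ y, Finset.univ.sup' Finset.univ_nonempty (fun i => b i + l i y) ∂ν)
    (ε : ℝ) (hε : 0 < ε) :
    ∃ w : I → E → ℝ, (∀ i, Measurable (w i)) ∧ (∀ i y, 0 ≤ w i y) ∧ (∀ y, ∑ i, w i y = 1) ∧
      (∀ i, ∫ y, w i y ∂ν = a i) ∧ (∀ i, ‖∫ y, w i y • y ∂ν - z i‖ ≤ ε) := by
  set C := ∫ y, ‖y‖ ∂ν with hC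
  have hC0 : 0 ≤ C := integral_nonneg fun _ => norm_nonneg _
  -- θ (2 C + 1) ≤ ε, θ < 1
  set θ := min (1/2) (ε / (2 * C + 1)) with hθ
  have hθ0 : 0 < θ := by positivity
  have hθ1 : θ ≤ 1/2 := min_le_left _ _
  have hθε : θ * (2 * C + 1) ≤ ε := by
    have : θ ≤ ε / (2 * C + 1) := min_le_right _ _
    rwa [le_div_iff₀ (by positivity)] at this
  obtain ⟨i₀, _, hi₀⟩ := Finset.exists_mem_eq_inf' (s := (Finset.univ : Finset I))
    Finset.univ_nonempty a
  have hmin : ∀ i, a i₀ ≤ a i := fun i => by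
    rw [← hi₀]; exact Finset.inf'_le _ (Finset.mem_univ i)
  obtain ⟨w, hm, h0, h1, hwa, hwz⟩ := strassen_closure ν hν a z h (θ * min 1 (a i₀))
    (by have := ha i₀; positivity)
  have hle1 : ∀ i y, w i y ≤ 1 := fun i y => by
    rw [← h1 y]; exact Finset.single_le_sum (f := fun i => w i y) (fun j _ => h0 j y) (Finset.mem_univ i)
  have hb : ∀ i y, ‖w i y‖ ≤ 1 := fun i y => by
      rw [Real.norm_eq_abs, abs_of_nonneg (h0 i y)]; exact hle1 i y
  have hi1 : ∀ i, Integrable (w i) ν := fun i =>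
    Integrable.of_bound (hm i).aestronglyMeasurable 1 (Filter.Eventually.of_forall (hb i))
  have hi2 : ∀ i, Integrable (fun y => w i y • y) ν := fun i =>
    hν.bdd_smul 1 (hm i).aestronglyMeasurable (Filter.Eventually.of_forall (hb i))
  set a' : I → ℝ := fun i => ∫ y, w i y ∂ν with ha'
  have ha'1 : ∑ i, a' i = 1 := by
    simp only [ha']
    rw [← integral_finsetSum _ (fun i _ => hi1 i)]
    simp [h1]
  set v : I → ℝ := fun i => (a i - (1 - θ) * a' i) / θ with hv
  have hv0 : ∀ i, 0 ≤ v i := by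
    intro i
    refine div_nonneg ?_ hθ0.le
    have h3 : a' i - a i ≤ θ * a i := by
      have h4 := (abs_lt.1 (hwa i)).2.le
      have h5 : θ * min 1 (a i₀) ≤ θ * a i :=
        mul_le_mul_of_nonneg_left ((min_le_right _ _).trans (hmin i)) hθ0.le
      simp only [ha']; linarith
    have := ha i
    nlinarith [mul_nonneg (mul_nonneg hθ0.le hθ0.le) this.le, mul_le_mul_of_nonneg_left h3 (by linarith : 0 ≤ 1 - θ)]
  have hvθ : ∀ i, θ * v i = a i - (1 - θ) * a' i := fun i => by
    simp only [hv]; field_simp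
  have hv1 : ∑ i, v i = 1 := by
    have : θ * ∑ i, v i = θ * 1 := by
      rw [Finset.mul_sum, Finset.sum_congr rfl (fun i _ => hvθ i), Finset.sum_sub_distrib,
        ← Finset.mul_sum, ha1, ha'1]; ring
    exact mul_left_cancel₀ hθ0.ne' this
  have hvle : ∀ i, v i ≤ 1 := fun i => by
    rw [← hv1]; exact Finset.single_le_sum (fun j _ => hv0 j) (Finset.mem_univ i)
  refine ⟨fun i y => (1 - θ) * w i y + θ * v i, fun i => by have := hm i; fun_prop,
    fun i y => add_nonneg (mul_nonneg (by linarith) (h0 i y)) (mul_nonneg hθ0.le (hv0 i)),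
    fun y => ?_, fun i => ?_, fun i => ?_⟩
  · rw [Finset.sum_add_distrib, ← Finset.mul_sum, ← Finset.mul_sum, h1, hv1]; ring
  · rw [integral_add ((hi1 i).const_mul _) (integrable_const _), integral_const_mul]
    simp only [integral_const, probReal_univ, one_smul, hvθ]
    simp [ha']
  · have e : ∫ y, ((1 - θ) * w i y + θ * v i) • y ∂ν =
        (1 - θ) • ∫ y, w i y • y ∂ν + (θ * v i) • ∫ y, y ∂ν := by
      rw [← integral_smul, ← integral_smul, ← integral_add
        (show Integrable (fun y => (1 - θ) • w i y • y) ν from (hi2 i).smul _)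
        (show Integrable (fun y => (θ * v i) • y) ν from hν.smul _)]
      refine integral_congr_ae (Filter.Eventually.of_forall fun y => ?_)
      simp only [add_smul, mul_smul]
    have n1 : ‖∫ y, w i y • y ∂ν‖ ≤ C := by
      refine norm_integral_le_of_norm_le hν.norm (Filter.Eventually.of_forall fun y => ?_)
      rw [norm_smul]
      exact mul_le_of_le_one_left (norm_nonneg _) (hb i y)
    have n2 : ‖∫ y, y ∂ν‖ ≤ C := norm_integral_le_integral_norm _
    rw [e]
    have : (1 - θ) • ∫ y, w i y • y ∂ν + (θ * v i) • ∫ y, y ∂ν - z i =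
        (∫ y, w i y • y ∂ν - z i) - θ • ∫ y, w i y • y ∂ν + (θ * v i) • ∫ y, y ∂ν := by
      rw [sub_smul, one_smul]; abel
    rw [this]
    have q1 : ‖θ • ∫ y, w i y • y ∂ν‖ ≤ θ * C := by
      rw [norm_smul, Real.norm_eq_abs, abs_of_pos hθ0]
      exact mul_le_mul_of_nonneg_left n1 hθ0.le
    have q2 : ‖(θ * v i) • ∫ y, y ∂ν‖ ≤ θ * C := by
      rw [norm_smul, Real.norm_eq_abs, abs_of_nonneg (mul_nonneg hθ0.le (hv0 i))]
      exact mul_le_mul (mul_le_of_le_one_right hθ0.le (hvle i)) n2 (norm_nonneg _) hθ0.le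
    have q3 : ‖∫ y, w i y • y ∂ν - z i‖ ≤ θ := (hwz i).le.trans
      (mul_le_of_le_one_right hθ0.le (min_le_left _ _))
    have t1 := norm_add_le ((∫ y, w i y • y ∂ν - z i) - θ • ∫ y, w i y • y ∂ν)
      ((θ * v i) • ∫ y, y ∂ν)
    have t2 := norm_sub_le (∫ y, w i y • y ∂ν - z i) (θ • ∫ y, w i y • y ∂ν)
    linarith

lemma exists_partition (p : ℝ≥0∞) (hp : p ≠ ∞) (μ : Measure E) [IsProbabilityMeasure μ]
    (hμ : MemLp (fun x : E => x) p μ) (ε : ℝ≥0∞) (hε : ε ≠ 0) :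
    ∃ (S : Finset E) (ι : E → S), Measurable ι ∧ (∀ i, μ (ι ⁻¹' {i}) ≠ 0) ∧
      eLpNorm (fun x => x - (ι x : E)) p μ < ε := by
  classical
  obtain ⟨s, hs, -⟩ := hμ.exists_simpleFunc_eLpNorm_sub_lt hp hε
  let S : Finset E := s.range.filter fun c => μ (s ⁻¹' {c}) ≠ 0
  have hae : ∀ᵐ x ∂μ, s x ∈ S := by
    have : {x | s x ∉ S} ⊆ ⋃ c ∈ s.range.filter (fun c => μ (s ⁻¹' {c}) = 0), s ⁻¹' {c} := by
      intro x hx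
      have hx' : ¬ (s x ∈ s.range ∧ μ (s ⁻¹' {s x}) ≠ 0) := fun h => hx (Finset.mem_filter.2 h)
      have : μ (s ⁻¹' {s x}) = 0 := by
        by_contra h
        exact hx' ⟨s.mem_range_self x, h⟩
      simp only [mem_iUnion]
      exact ⟨s x, Finset.mem_filter.2 ⟨s.mem_range_self x, this⟩, rfl⟩
    refine measure_mono_null this ?_
    refine (measure_biUnion_null_iff (Finset.countable_toSet _)).2 fun c hc => ?_
    exact (Finset.mem_filter.1 hc).2
  obtain ⟨x₀, hx₀⟩ := hae.exists
  let f : E → S := fun c => if h : c ∈ S then ⟨c, h⟩ else ⟨s x₀, hx₀⟩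
  have hιs : ∀ᵐ x ∂μ, ((s.map f) x : E) = s x := by
    filter_upwards [hae] with x hx
    simp [f, hx]
  refine ⟨S, s.map f, (s.map f).measurable, fun i h0 => ?_, ?_⟩
  · have hi := (Finset.mem_filter.1 i.2).2
    apply hi
    refine le_antisymm (le_trans (measure_mono_ae ?_) h0.le) bot_le
    filter_upwards [hιs] with x hx hxi
    have : s x = i := hxi
    exact Subtype.ext (hx.trans this)
  · refine lt_of_eq_of_lt (eLpNorm_congr_ae ?_) hs
    filter_upwards [hιs] with x hx
    simp only [Pi.sub_apply, hx]

lemma sup_convex {I : Type*} [Fintype I] [Nonempty I] (b : I → ℝ) (l : I → E →L[ℝ] ℝ) :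
    ConvexOn ℝ univ
      (fun y => Finset.univ.sup' Finset.univ_nonempty (fun i => b i + l i y)) := by
  refine ⟨convex_univ, fun x _ y _ s t hs ht hst => ?_⟩
  refine Finset.sup'_le _ _ fun i _ => ?_
  have h1 := Finset.le_sup' (fun i => b i + l i x) (Finset.mem_univ i)
  have h2 := Finset.le_sup' (fun i => b i + l i y) (Finset.mem_univ i)
  have e : b i + l i (s • x + t • y) = s * (b i + l i x) + t * (b i + l i y) := by
    simp only [map_add, map_smul, smul_eq_mul]
    have : b i = (s + t) * b i := by rw [hst, one_mul]
    linear_combination this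
  rw [e, smul_eq_mul, smul_eq_mul]
  exact add_le_add (mul_le_mul_of_nonneg_left h1 hs) (mul_le_mul_of_nonneg_left h2 ht)

lemma sup_integrable {I : Type*} [Fintype I] [Nonempty I] (b : I → ℝ) (l : I → E →L[ℝ] ℝ)
    (P : Measure E) [IsProbabilityMeasure P] (hP : Integrable (fun y : E => y) P) :
    Integrable (fun y => Finset.univ.sup' Finset.univ_nonempty (fun i => b i + l i y)) P := by
  have hi : Integrable (fun y => ∑ i, ‖b i + l i y‖) P := by
    refine integrable_finsetSum _ fun i _ => ?_
    exact ((integrable_const (b i)).add ((l i).integrable_comp hP)).norm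
  refine hi.mono' ?_ (Filter.Eventually.of_forall fun y => ?_)
  · exact (sup_convex b l).locallyLipschitz.continuous.aestronglyMeasurable
  · obtain ⟨i, _, hi⟩ := Finset.exists_mem_eq_sup' (s := (Finset.univ : Finset I))
        Finset.univ_nonempty (fun i => b i + l i y)
    rw [hi]
    exact Finset.single_le_sum (f := fun i => ‖b i + l i y‖) (fun j _ => norm_nonneg _)
      (Finset.mem_univ i)

lemma integrable_of_convexOrder (η ν : Measure E) (h : ConvexOrder η ν)
    (hν : Integrable (fun y : E => y) ν) : Integrable (fun y : E => y) η := by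
  refine ⟨by fun_prop, ?_⟩
  have := h.1 (fun x => ‖x‖) (convexOn_norm convex_univ) (fun x => norm_nonneg x)
  simp only [ofReal_norm] at this
  exact this.trans_lt hν.2

/-- The test inequality of `strassen_finite` for a coupling with second marginal `≤cx ν`. -/
lemma test_ineq {I : Type*} [Fintype I] [Nonempty I] [MeasurableSpace I]
    [MeasurableSingletonClass I]
    (μ ν : Measure E) [IsProbabilityMeasure μ] [IsProbabilityMeasure ν]
    (hν : Integrable (fun y : E => y) ν) (ι : E → I) (hι : Measurable ι)
    (π : Measure (E × E)) [IsProbabilityMeasure π] (h1 : π.map Prod.fst = μ)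
    (h2 : ConvexOrder (π.map Prod.snd) ν)
    (b : I → ℝ) (l : I → E →L[ℝ] ℝ) :
    ∑ i, (b i * μ.real (ι ⁻¹' {i}) +
      l i (∫ p in (fun p : E × E => ι p.1) ⁻¹' {i}, p.2 ∂π)) ≤
      ∫ y, Finset.univ.sup' Finset.univ_nonempty (fun i => b i + l i y) ∂ν := by
  have hη := integrable_of_convexOrder _ _ h2 hν
  have : IsProbabilityMeasure (π.map Prod.snd) :=
    Measure.isProbabilityMeasure_map measurable_snd.aemeasurable
  set S : E → ℝ := fun y => Finset.univ.sup' Finset.univ_nonempty (fun i => b i + l i y) with hS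
  have hSη := sup_integrable b l _ hη
  have hSν := sup_integrable b l _ hν
  have hle := h2.2 S (sup_convex b l) (hSη.add_measure hSν)
  refine le_trans ?_ hle
  rw [integral_map measurable_snd.aemeasurable hSη.aestronglyMeasurable]
  have hp2 : Integrable (fun p : E × E => p.2) π := hη.comp_measurable measurable_snd
  have hSp : Integrable (fun p : E × E => S p.2) π := hSη.comp_measurable measurable_snd
  let B : I → Set (E × E) := fun i => (fun p : E × E => ι p.1) ⁻¹' {i}
  have hB : ∀ i, MeasurableSet (B i) := fun i => (hι.comp measurable_fst) (measurableSet_singleton i)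
  have hBu : ⋃ i, B i = univ := by ext p; simp [B]
  have hBd : Pairwise (Function.onFun Disjoint B) := by
    intro i j hij
    refine disjoint_left.2 fun p hp hp' => hij ?_
    have h3 : ι p.1 = i := hp
    have h4 : ι p.1 = j := hp'
    exact h3.symm.trans h4
  rw [← setIntegral_univ, ← hBu, integral_iUnion_fintype hB hBd (fun i => hSp.integrableOn)]
  refine Finset.sum_le_sum fun i _ => ?_
  have ea : μ.real (ι ⁻¹' {i}) = π.real (B i) := by
    rw [← h1, measureReal_def, Measure.map_apply measurable_fst (hι (measurableSet_singleton i))]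
    rfl
  have hi2 : IntegrableOn (fun p : E × E => l i p.2) (B i) π :=
    ((l i).integrable_comp hp2).integrableOn
  rw [ea, ← ContinuousLinearMap.integral_comp_comm _ hp2.integrableOn]
  have e2 : b i * π.real (B i) = ∫ p in B i, b i ∂π := by
    simp [mul_comm]
  rw [e2]
  change ∫ p in B i, b i ∂π + ∫ p in B i, l i p.2 ∂π ≤ _
  rw [← integral_add (integrable_const _) hi2]
  refine setIntegral_mono ((integrable_const _).add hi2) hSp.integrableOn fun p => ?_
  exact Finset.le_sup' (fun i => b i + l i p.2) (Finset.mem_univ i)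

lemma exists_kernel {I : Type*} [Fintype I] [Nonempty I] [MeasurableSpace I]
    [MeasurableSingletonClass I]
    (μ ν : Measure E) [IsProbabilityMeasure μ] [IsProbabilityMeasure ν]
    (ι : E → I) (hι : Measurable ι) (hpos : ∀ i, μ (ι ⁻¹' {i}) ≠ 0)
    (w : I → E → ℝ) (hm : ∀ i, Measurable (w i)) (h0 : ∀ i y, 0 ≤ w i y)
    (h1 : ∀ y, ∑ i, w i y = 1) (hw : ∀ i, ∫ y, w i y ∂ν = μ.real (ι ⁻¹' {i})) :
    ∃ R : Kernel E E, IsMarkovKernel R ∧ μ.bind ⇑R = ν ∧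
      ∀ x, ∫ y, y ∂(R x) = (μ.real (ι ⁻¹' {ι x}))⁻¹ • ∫ y, w (ι x) y • y ∂ν := by
  set a : I → ℝ := fun i => μ.real (ι ⁻¹' {i}) with ha
  have ha0 : ∀ i, 0 < a i := fun i => by
    simp only [ha, measureReal_def]
    exact ENNReal.toReal_pos (hpos i) (measure_ne_top _ _)
  have hle1 : ∀ i y, w i y ≤ 1 := fun i y => by
    rw [← h1 y]
    exact Finset.single_le_sum (f := fun i => w i y) (fun j _ => h0 j y) (Finset.mem_univ i)
  have hi1 : ∀ i, Integrable (w i) ν := fun i =>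
    Integrable.of_bound (hm i).aestronglyMeasurable 1 (Filter.Eventually.of_forall fun y => by
      rw [Real.norm_eq_abs, abs_of_nonneg (h0 i y)]; exact hle1 i y)
  let k : Kernel I E := Kernel.ofFunOfCountable fun i =>
    ν.withDensity (fun y => ENNReal.ofReal ((a i)⁻¹ * w i y))
  have hk : ∀ i, k i = ν.withDensity (fun y => ENNReal.ofReal ((a i)⁻¹ * w i y)) := fun i => rfl
  have hdm : ∀ i, Measurable (fun y => ENNReal.ofReal ((a i)⁻¹ * w i y)) := fun i => by
    have := hm i; fun_prop
  refine ⟨k.comap ι hι, ⟨fun x => ⟨?_⟩⟩, ?_, fun x => ?_⟩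
  · rw [Kernel.comap_apply, hk, withDensity_apply _ MeasurableSet.univ, Measure.restrict_univ,
      ← ofReal_integral_eq_lintegral_ofReal ((hi1 _).const_mul _)
        (Filter.Eventually.of_forall fun y => mul_nonneg (inv_nonneg.2 (ha0 _).le) (h0 _ _)),
      integral_const_mul, hw]
    change ENNReal.ofReal ((a (ι x))⁻¹ * a (ι x)) = 1
    rw [inv_mul_cancel₀ (ha0 _).ne', ENNReal.ofReal_one]
  · ext B hB
    rw [Measure.bind_apply hB (Kernel.measurable _).aemeasurable]
    simp only [Kernel.comap_apply]
    rw [← lintegral_map (f := fun i => k i B) (Kernel.measurable_coe k hB) hι, lintegral_fintype]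
    have : ∀ i, k i B * (μ.map ι) {i} = ∫⁻ y in B, ENNReal.ofReal (w i y) ∂ν := by
      intro i
      rw [Measure.map_apply hι (measurableSet_singleton i), hk, withDensity_apply _ hB,
        ← ENNReal.ofReal_toReal (measure_ne_top μ (ι ⁻¹' {i})), ← lintegral_mul_const _ (hdm i)]
      refine lintegral_congr fun y => ?_
      change _ * ENNReal.ofReal (a i) = _
      rw [← ENNReal.ofReal_mul (mul_nonneg (inv_nonneg.2 (ha0 _).le) (h0 _ _))]
      congr 1
      have := (ha0 i).ne'
      field_simp
    rw [Finset.sum_congr rfl (fun i _ => this i),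
      ← lintegral_finsetSum _ (fun i _ => by have := hm i; fun_prop)]
    have e : ∀ y, ∑ i, ENNReal.ofReal (w i y) = 1 := fun y => by
      rw [← ENNReal.ofReal_sum_of_nonneg (fun i _ => h0 i y), h1, ENNReal.ofReal_one]
    simp [e]
  · rw [Kernel.comap_apply, hk, integral_withDensity_eq_integral_toReal_smul (hdm _)
      (Filter.Eventually.of_forall fun y => ENNReal.ofReal_lt_top), ← integral_smul]
    refine integral_congr_ae (Filter.Eventually.of_forall fun y => ?_)
    simp only
    rw [ENNReal.toReal_ofReal (mul_nonneg (inv_nonneg.2 (ha0 _).le) (h0 _ _)), mul_smul]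

/-- Averaging contracts the cost. -/
lemma average_cost (ρ : ℝ) (hρ : 1 < ρ) {I : Type*} [Fintype I] [MeasurableSpace I]
    [MeasurableSingletonClass I]
    (μ : Measure E) [IsProbabilityMeasure μ]
    (ι : E → I) (hι : Measurable ι) (hpos : ∀ i, μ (ι ⁻¹' {i}) ≠ 0) (σ : I → E)
    (π : Measure (E × E)) [IsProbabilityMeasure π] (h1 : π.map Prod.fst = μ)
    (h2 : Integrable (fun p : E × E => p.2) π) :
    ∫⁻ x, ENNReal.ofReal (‖σ (ι x) - (μ.real (ι ⁻¹' {ι x}))⁻¹ •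
      ∫ p in (fun p : E × E => ι p.1) ⁻¹' {ι x}, p.2 ∂π‖ ^ ρ) ∂μ ≤
    ∫⁻ p, ENNReal.ofReal (‖σ (ι p.1) - p.2‖ ^ ρ) ∂π := by
  let B : I → Set (E × E) := fun i => (fun p : E × E => ι p.1) ⁻¹' {i}
  have hB : ∀ i, MeasurableSet (B i) := fun i => (hι.comp measurable_fst) (measurableSet_singleton i)
  have hBu : ⋃ i, B i = univ := by ext p; simp [B]
  have hBd : Pairwise (Function.onFun Disjoint B) := by
    intro i j hij
    refine disjoint_left.2 fun p hp hp' => hij ?_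
    have h3 : ι p.1 = i := hp
    have h4 : ι p.1 = j := hp'
    exact h3.symm.trans h4
  have hBμ : ∀ i, μ (ι ⁻¹' {i}) = π (B i) := fun i => by
    rw [← h1, Measure.map_apply measurable_fst (hι (measurableSet_singleton i))]
    rfl
  rw [← lintegral_map (f := fun i => ENNReal.ofReal (‖σ i - (μ.real (ι ⁻¹' {i}))⁻¹ •
      ∫ p in B i, p.2 ∂π‖ ^ ρ)) (measurable_of_finite _) hι, lintegral_fintype]
  conv_rhs => rw [← setLIntegral_univ, ← hBu, lintegral_iUnion hB hBd, tsum_fintype]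
  refine Finset.sum_le_sum fun i _ => ?_
  rw [Measure.map_apply hι (measurableSet_singleton i), hBμ, measureReal_def, hBμ]
  have hne : π (B i) ≠ 0 := by rw [← hBμ]; exact hpos i
  have hPm : IsProbabilityMeasure (π[|B i]) := cond_isProbabilityMeasure hne
  have hf : Integrable (fun p : E × E => σ i - p.2) π := (integrable_const _).sub h2
  have hPi : Integrable (fun p : E × E => σ i - p.2) (π[|B i]) := by
    rw [ProbabilityTheory.cond]
    exact hf.integrableOn.smul_measure (ENNReal.inv_ne_top.2 hne)
  have hj := jensen_lintegral (π[|B i]) _ hPi (fun x => ‖x‖ ^ ρ) (convexOn_norm_rpow ρ hρ)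
    (fun x => by positivity)
  have e1 : ∫ p, (σ i - p.2) ∂(π[|B i]) = σ i - (π (B i)).toReal⁻¹ • ∫ p in B i, p.2 ∂π := by
    rw [ProbabilityTheory.cond, integral_smul_measure,
      integral_sub (integrable_const _) h2.integrableOn, smul_sub, ENNReal.toReal_inv]
    congr 1
    have : (π (B i)).toReal ≠ 0 := (ENNReal.toReal_pos hne (measure_ne_top _ _)).ne'
    simp [measureReal_def, smul_smul, inv_mul_cancel₀ this]
  have e2 : ∫⁻ p, ENNReal.ofReal (‖σ i - p.2‖ ^ ρ) ∂(π[|B i]) =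
      (π (B i))⁻¹ * ∫⁻ p in B i, ENNReal.ofReal (‖σ (ι p.1) - p.2‖ ^ ρ) ∂π := by
    rw [ProbabilityTheory.cond, lintegral_smul_measure, smul_eq_mul]
    congr 1
    refine setLIntegral_congr_fun (hB i) fun p hp => ?_
    have : ι p.1 = i := hp
    simp only [this]
  rw [e1, e2] at hj
  calc _ ≤ ((π (B i))⁻¹ * ∫⁻ p in B i, ENNReal.ofReal (‖σ (ι p.1) - p.2‖ ^ ρ) ∂π) * π (B i) := by
        gcongr
    _ = _ := by
        rw [mul_comm, ← mul_assoc, ENNReal.mul_inv_cancel hne (measure_ne_top _ _), one_mul]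

lemma approx_kernel (ρ : ℝ) (hρ : 1 < ρ)
    (μ ν : Measure E) [IsProbabilityMeasure μ] [IsProbabilityMeasure ν]
    (hμ : MemLp (fun x : E => x) (ENNReal.ofReal ρ) μ)
    (hν : Integrable (fun y : E => y) ν)
    (π : Measure (E × E)) (h1 : π.map Prod.fst = μ) (h2 : ConvexOrder (π.map Prod.snd) ν)
    (ε : ℝ) (hε : 0 < ε) :
    ∃ R : Kernel E E, IsMarkovKernel R ∧ μ.bind ⇑R = ν ∧
      eLpNorm (fun x => x - ∫ y, y ∂(R x)) (ENNReal.ofReal ρ) μ ≤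
        eLpNorm (fun p : E × E => p.1 - p.2) (ENNReal.ofReal ρ) π + ENNReal.ofReal ε := by
  classical
  have hρ0 : 0 < ρ := by linarith
  have hp1 : 1 ≤ ENNReal.ofReal ρ := by rw [ENNReal.one_le_ofReal]; exact hρ.le
  have hP : IsProbabilityMeasure π := by
    constructor
    have : (π.map Prod.fst) univ = 1 := by rw [h1]; simp
    rwa [Measure.map_apply measurable_fst MeasurableSet.univ] at this
  have hη := integrable_of_convexOrder _ _ h2 hν
  have hp2 : Integrable (fun p : E × E => p.2) π := hη.comp_measurable measurable_snd
  obtain ⟨S, ι, hι, hpos, happ⟩ := exists_partition (ENNReal.ofReal ρ) (by simp) μ hμ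
    (ENNReal.ofReal (ε / 3)) (by simpa using hε)
  have hSne : Nonempty S := ⟨ι 0⟩
  set a : S → ℝ := fun i => μ.real (ι ⁻¹' {i}) with ha
  set z : S → E := fun i => ∫ p in (fun p : E × E => ι p.1) ⁻¹' {i}, p.2 ∂π with hz
  have ha0 : ∀ i, 0 < a i := fun i => by
    simp only [ha, measureReal_def]
    exact ENNReal.toReal_pos (hpos i) (measure_ne_top _ _)
  have ha1 : ∑ i, a i = 1 := by
    simp only [ha]
    rw [sum_measureReal_preimage_singleton _ (fun i _ => hι (measurableSet_singleton i))]
    simp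
  obtain ⟨i₀, _, hi₀⟩ := Finset.exists_mem_eq_inf' (s := (Finset.univ : Finset S))
    Finset.univ_nonempty a
  have hmin : ∀ i, a i₀ ≤ a i := fun i => by
    rw [← hi₀]; exact Finset.inf'_le _ (Finset.mem_univ i)
  obtain ⟨w, hwm, hw0, hw1, hwa, hwz⟩ := strassen_finite ν hν a ha0 ha1 z
    (test_ineq μ ν hν ι hι π h1 h2) (ε / 3 * a i₀) (mul_pos (by positivity) (ha0 i₀))
  obtain ⟨R, hR, hRν, hRm⟩ := exists_kernel μ ν ι hι hpos w hwm hw0 hw1 hwa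
  refine ⟨R, hR, hRν, ?_⟩
  have hιm : Measurable fun x => (ι x : E) := measurable_subtype_coe.comp hι
  let yb : S → E := fun i => (a i)⁻¹ • z i
  have hybm : Measurable fun x => yb (ι x) := (measurable_of_finite yb).comp hι
  have hRmm := measurable_mean R
  have d1 : eLpNorm (fun x => yb (ι x) - ∫ y, y ∂(R x)) (ENNReal.ofReal ρ) μ
      ≤ ENNReal.ofReal (ε / 3) := by
    have := eLpNorm_le_of_ae_bound (p := ENNReal.ofReal ρ) (μ := μ) (C := ε / 3)
      (f := fun x => yb (ι x) - ∫ y, y ∂(R x)) (Filter.Eventually.of_forall fun x => ?_)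
    · simpa using this
    · simp only [yb]
      rw [hRm x]
      change ‖(a (ι x))⁻¹ • z (ι x) - (a (ι x))⁻¹ • ∫ y, w (ι x) y • y ∂ν‖ ≤ _
      rw [← smul_sub, norm_smul, norm_inv, Real.norm_eq_abs, abs_of_pos (ha0 _),
        inv_mul_le_iff₀ (ha0 _), norm_sub_rev, mul_comm]
      exact (hwz _).trans (mul_le_mul_of_nonneg_left (hmin _) (by positivity))
  have d2 : eLpNorm (fun x => (ι x : E) - yb (ι x)) (ENNReal.ofReal ρ) μ ≤
      eLpNorm (fun p : E × E => (ι p.1 : E) - p.2) (ENNReal.ofReal ρ) π := by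
    have := average_cost ρ hρ μ ι hι hpos (fun i => (i : E)) π h1 hp2
    rw [cost_eq_eLpNorm ρ hρ, cost_eq_eLpNorm ρ hρ] at this
    exact (ENNReal.rpow_le_rpow_iff hρ0).1 this
  have d3 : eLpNorm (fun p : E × E => p.1 - (ι p.1 : E)) (ENNReal.ofReal ρ) π =
      eLpNorm (fun x => x - (ι x : E)) (ENNReal.ofReal ρ) μ := by
    rw [← h1, eLpNorm_map_measure (by fun_prop) measurable_fst.aemeasurable]
    rfl
  have d4 : eLpNorm (fun p : E × E => (ι p.1 : E) - p.2) (ENNReal.ofReal ρ) π ≤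
      eLpNorm (fun p : E × E => p.1 - (ι p.1 : E)) (ENNReal.ofReal ρ) π +
      eLpNorm (fun p : E × E => p.1 - p.2) (ENNReal.ofReal ρ) π := by
    have hι1 : Measurable fun p : E × E => (ι p.1 : E) := hιm.comp measurable_fst
    have := eLpNorm_add_le (μ := π) (p := ENNReal.ofReal ρ)
      (f := fun p : E × E => (ι p.1 : E) - p.1) (g := fun p : E × E => p.1 - p.2)
      (by fun_prop) (by fun_prop) hp1
    have e : (fun p : E × E => (ι p.1 : E) - p.1) + (fun p : E × E => p.1 - p.2) =
      fun p : E × E => (ι p.1 : E) - p.2 := by funext p; simp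
    rw [e] at this
    have e2 : eLpNorm (fun p : E × E => (ι p.1 : E) - p.1) (ENNReal.ofReal ρ) π =
      eLpNorm (fun p : E × E => p.1 - (ι p.1 : E)) (ENNReal.ofReal ρ) π :=
      eLpNorm_congr_norm_ae (Filter.Eventually.of_forall fun p => norm_sub_rev _ _)
    rwa [e2] at this
  have d5 : eLpNorm (fun x => x - ∫ y, y ∂(R x)) (ENNReal.ofReal ρ) μ ≤
      eLpNorm (fun x => x - (ι x : E)) (ENNReal.ofReal ρ) μ +
      (eLpNorm (fun x => (ι x : E) - yb (ι x)) (ENNReal.ofReal ρ) μ +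
      eLpNorm (fun x => yb (ι x) - ∫ y, y ∂(R x)) (ENNReal.ofReal ρ) μ) := by
    have e : (fun x => x - ∫ y, y ∂(R x)) = (fun x => x - (ι x : E)) +
        ((fun x => (ι x : E) - yb (ι x)) + (fun x => yb (ι x) - ∫ y, y ∂(R x))) := by
      funext x; simp
    rw [e]
    refine (eLpNorm_add_le ?_ ?_ hp1).trans (add_le_add le_rfl (eLpNorm_add_le ?_ ?_ hp1))
    · exact (measurable_id.sub hιm).aestronglyMeasurable
    · exact ((hιm.sub hybm).add (hybm.sub hRmm)).aestronglyMeasurable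
    · exact (hιm.sub hybm).aestronglyMeasurable
    · exact (hybm.sub hRmm).aestronglyMeasurable
  rw [d3] at d4
  have he : ENNReal.ofReal ε = ENNReal.ofReal (ε/3) + ENNReal.ofReal (ε/3) + ENNReal.ofReal (ε/3) := by
    rw [← ENNReal.ofReal_add (by positivity) (by positivity),
      ← ENNReal.ofReal_add (by positivity) (by positivity)]
    congr 1; ring
  set X := eLpNorm (fun p : E × E => p.1 - p.2) (ENNReal.ofReal ρ) π
  calc _ ≤ ENNReal.ofReal (ε/3) + ((ENNReal.ofReal (ε/3) + X) + ENNReal.ofReal (ε/3)) :=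
        d5.trans (add_le_add happ.le (add_le_add (d2.trans (d4.trans (add_le_add happ.le le_rfl))) d1))
    _ = _ := by rw [he]; ring

lemma inf_le_cost (ρ : ℝ) (hρ : 1 < ρ)
    (μ ν : Measure E) [IsProbabilityMeasure μ] [IsProbabilityMeasure ν]
    (hμ : MemLp (fun x : E => x) (ENNReal.ofReal ρ) μ)
    (hν : Integrable (fun y : E => y) ν)
    (π : Measure (E × E)) (h1 : π.map Prod.fst = μ) (h2 : ConvexOrder (π.map Prod.snd) ν) :
    (⨅ (R : Kernel E E) (_ : IsMarkovKernel R) (_ : μ.bind ⇑R = ν),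
      ∫⁻ x, ENNReal.ofReal (‖x - ∫ y, y ∂(R x)‖ ^ ρ) ∂μ) ≤
    ∫⁻ p, ENNReal.ofReal (‖p.1 - p.2‖ ^ ρ) ∂π := by
  have hρ0 : 0 < ρ := by linarith
  set Jinf := (⨅ (R : Kernel E E) (_ : IsMarkovKernel R) (_ : μ.bind ⇑R = ν),
      ∫⁻ x, ENNReal.ofReal (‖x - ∫ y, y ∂(R x)‖ ^ ρ) ∂μ)
  rw [cost_eq_eLpNorm ρ hρ, ← ENNReal.rpow_inv_le_iff hρ0]
  refine ENNReal.le_of_forall_pos_le_add fun ε hε _ => ?_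
  obtain ⟨R, hR, hRν, hle⟩ := approx_kernel ρ hρ μ ν hμ hν π h1 h2 ε hε
  rw [ENNReal.ofReal_coe_nnreal] at hle
  refine le_trans ?_ hle
  rw [ENNReal.rpow_inv_le_iff hρ0, ← cost_eq_eLpNorm ρ hρ]
  exact iInf_le_of_le R (iInf_le_of_le hR (iInf_le _ hRν))

lemma inf_ne_top (ρ : ℝ) (hρ : 1 < ρ)
    (μ ν : Measure E) [IsProbabilityMeasure μ] [IsProbabilityMeasure ν]
    (hμ : MemLp (fun x : E => x) (ENNReal.ofReal ρ) μ) :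
    (⨅ (R : Kernel E E) (_ : IsMarkovKernel R) (_ : μ.bind ⇑R = ν),
      ∫⁻ x, ENNReal.ofReal (‖x - ∫ y, y ∂(R x)‖ ^ ρ) ∂μ) ≠ ∞ := by
  have hρ0 : 0 < ρ := by linarith
  refine ne_top_of_le_ne_top ?_ (iInf_le_of_le (Kernel.const E ν)
    (iInf_le_of_le inferInstance (iInf_le _ ?_)))
  · rw [cost_eq_eLpNorm ρ hρ]
    simp only [Kernel.const_apply]
    exact ENNReal.rpow_ne_top_of_nonneg hρ0.le (hμ.sub (memLp_const _)).2.ne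
  · ext B hB
    rw [Measure.bind_apply hB (Kernel.measurable _).aemeasurable]
    simp

lemma eq_graph_of_small (μ : Measure E) (m : E → E) (hm : Measurable m)
    (π' : Measure (E × E)) (h1 : π'.map Prod.fst = μ)
    (h : ∀ δ : ℝ, 0 < δ → π' {p | δ ≤ ‖p.2 - m p.1‖} ≤ ENNReal.ofReal δ) :
    π' = μ.map (fun x => (x, m x)) := by
  have hz : ∀ δ : ℝ, 0 < δ → π' {p | δ ≤ ‖p.2 - m p.1‖} = 0 := by
    intro δ hδ
    refine le_antisymm (ENNReal.le_of_forall_pos_le_add fun ε hε _ => ?_) bot_le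
    rw [zero_add]
    refine le_trans (measure_mono ?_) ((h (min δ ε) (lt_min hδ (by exact_mod_cast hε))).trans ?_)
    · intro p hp
      have hp2 : δ ≤ ‖p.2 - m p.1‖ := hp
      exact (min_le_left _ _).trans hp2
    · rw [← ENNReal.ofReal_coe_nnreal]
      exact ENNReal.ofReal_le_ofReal (min_le_right _ _)
  have hae : ∀ᵐ p ∂π', p.2 = m p.1 := by
    have : {p : E × E | ¬ p.2 = m p.1} ⊆ ⋃ n : ℕ, {p | 1 / ((n:ℝ) + 1) ≤ ‖p.2 - m p.1‖} := by
      intro p hp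
      have : 0 < ‖p.2 - m p.1‖ := norm_pos_iff.2 (sub_ne_zero.2 hp)
      obtain ⟨n, hn⟩ := exists_nat_one_div_lt this
      exact mem_iUnion.2 ⟨n, hn.le⟩
    refine measure_mono_null this (measure_iUnion_null fun n => hz _ (by positivity))
  have hmm : Measurable fun x => (x, m x) := by fun_prop
  rw [← h1, Measure.map_map hmm measurable_fst]
  conv_lhs => rw [← Measure.map_id (μ := π')]
  refine Measure.map_congr ?_
  filter_upwards [hae] with p hp
  exact Prod.ext rfl hp

lemma eq_proj_of_small (μ η : Measure E) [IsProbabilityMeasure μ] [IsProbabilityMeasure η]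
    (m : E → E) (hm : Measurable m)
    (h : ∀ δ : ℝ, 0 < δ → ∃ π' : Measure (E × E), π'.map Prod.fst = μ ∧ π'.map Prod.snd = η ∧
      π' {p | δ ≤ ‖p.2 - m p.1‖} ≤ ENNReal.ofReal δ) :
    η = μ.map m := by
  have : IsProbabilityMeasure (μ.map m) := Measure.isProbabilityMeasure_map hm.aemeasurable
  have hd : levyProkhorovEDist η (μ.map m) ≤ 0 := by
    refine levyProkhorovEDist_le_of_forall_le _ _ _ fun ε B hε hεt hB => ?_
    obtain ⟨π', h1, h2, h3⟩ := h ε.toReal (ENNReal.toReal_pos hε.ne' hεt.ne)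
    rw [ENNReal.ofReal_toReal hεt.ne] at h3
    have ho : MeasurableSet (Metric.thickening ε.toReal B) := Metric.isOpen_thickening.measurableSet
    rw [Measure.map_apply hm ho, ← h1, ← h2, Measure.map_apply measurable_snd hB,
      Measure.map_apply measurable_fst (hm ho)]
    refine le_trans (measure_mono ?_) ((measure_union_le _ _).trans (add_le_add le_rfl h3))
    intro p hp
    by_cases hlt : ε.toReal ≤ ‖p.2 - m p.1‖
    · exact Or.inr hlt
    · left
      refine Metric.mem_thickening_iff.2 ⟨p.2, hp, ?_⟩
      rw [dist_comm, dist_eq_norm]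
      exact not_le.1 hlt
  have hd0 : levyProkhorovEDist η (μ.map m) = 0 := le_antisymm hd bot_le
  refine ext_of_generate_finite _ ?_ isPiSystem_isClosed (fun A hA => ?_) (by simp)
  · rw [← borel_eq_generateFrom_isClosed]; exact BorelSpace.measurable_eq
  · exact measure_eq_measure_of_levyProkhorovEDist_eq_zero_of_isClosed hd0 hA
      ⟨1, one_pos, measure_ne_top _ _⟩ ⟨1, one_pos, measure_ne_top _ _⟩

end aux

/-- for `ρ > 1` and `μ, ν ∈ P_ρ(ℝ^d)`, all minimizing Markov kernels `R⋆` with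
`μR⋆ = ν` of `J_ρ` have `μ`-a.e. equal mean maps `m_{R⋆}`; `m_{R⋆}#μ` is the unique `η ≤cx ν`
minimizing `W_ρ(μ,η)^ρ`; and `μ(dx) δ_{m_{R⋆}(x)}(dy)` is the unique optimal coupling between
`μ` and `m_{R⋆}#μ`. -/
theorem stmt1 {d : ℕ} (ρ : ℝ) (hρ : 1 < ρ)
    (μ ν : Measure (EuclideanSpace ℝ (Fin d)))
    [IsProbabilityMeasure μ] [IsProbabilityMeasure ν]
    (hμρ : Integrable (fun x => ‖x‖ ^ ρ) μ) (hνρ : Integrable (fun x => ‖x‖ ^ ρ) ν) :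
    let E := EuclideanSpace ℝ (Fin d)
    let J : Kernel E E → ℝ≥0∞ :=
      fun R => ∫⁻ x, ENNReal.ofReal (‖x - ∫ y, y ∂(R x)‖ ^ ρ) ∂μ
    let Jinf := ⨅ (R : Kernel E E) (_ : IsMarkovKernel R) (_ : μ.bind ⇑R = ν), J R
    let Winf := ⨅ (η : Measure E) (_ : IsProbabilityMeasure η) (_ : ConvexOrder η ν), Wp ρ μ η
    (∀ R₁ R₂ : Kernel E E, IsMarkovKernel R₁ → μ.bind ⇑R₁ = ν → J R₁ = Jinf →
        IsMarkovKernel R₂ → μ.bind ⇑R₂ = ν → J R₂ = Jinf →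
        (fun x => ∫ y, y ∂(R₁ x)) =ᵐ[μ] (fun x => ∫ y, y ∂(R₂ x)))
    ∧ (∀ R : Kernel E E, IsMarkovKernel R → μ.bind ⇑R = ν → J R = Jinf →
        let m : E → E := fun x => ∫ y, y ∂(R x)
        let proj := μ.map m
        let π := μ.map (fun x => (x, m x))
        (ConvexOrder proj ν ∧ Wp ρ μ proj = Winf)
        ∧ (∀ η : Measure E, IsProbabilityMeasure η → ConvexOrder η ν →
            Wp ρ μ η = Winf → η = proj)
        ∧ (π.map Prod.fst = μ ∧ π.map Prod.snd = proj
            ∧ (∫⁻ p, ENNReal.ofReal (‖p.1 - p.2‖ ^ ρ) ∂π) = Wp ρ μ proj)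
        ∧ (∀ π' : Measure (E × E), π'.map Prod.fst = μ → π'.map Prod.snd = proj →
            (∫⁻ p, ENNReal.ofReal (‖p.1 - p.2‖ ^ ρ) ∂π') = Wp ρ μ proj → π' = π)) := by
  intro E J Jinf Winf
  have hρ0 : 0 < ρ := by linarith
  have hμ := integrable_id_of_rpow ρ hρ μ hμρ
  have hνL := integrable_id_of_rpow ρ hρ ν hνρ
  have hν : Integrable (fun y : E => y) ν :=
    hνL.integrable (by rw [ENNReal.one_le_ofReal]; exact hρ.le)
  have hmin : ∀ π' : Measure (E × E), π'.map Prod.fst = μ → ConvexOrder (π'.map Prod.snd) ν →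
      Jinf ≤ ∫⁻ p, ENNReal.ofReal (‖p.1 - p.2‖ ^ ρ) ∂π' :=
    fun π' h1 h2 => inf_le_cost ρ hρ μ ν hμ hν π' h1 h2
  have hfin : Jinf ≠ ∞ := inf_ne_top ρ hρ μ ν hμ
  have hWp : ∀ η : Measure E, ConvexOrder η ν → Jinf ≤ Wp ρ μ η := fun η hη =>
    le_iInf fun π' => le_iInf fun h1 => le_iInf fun h2 => hmin π' h1 (h2 ▸ hη)
  have hJW : Jinf ≤ Winf := le_iInf fun η => le_iInf fun _ => le_iInf fun hη => hWp η hη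
  -- couplings with optimal cost are carried by the graph of the mean map
  have huniq : ∀ R : Kernel E E, IsMarkovKernel R → μ.bind ⇑R = ν → J R = Jinf →
      ∀ π' : Measure (E × E), π'.map Prod.fst = μ → ConvexOrder (π'.map Prod.snd) ν →
      ∫⁻ p, ENNReal.ofReal (‖p.1 - p.2‖ ^ ρ) ∂π' ≤ Jinf →
      π' = μ.map (fun x => (x, ∫ y, y ∂(R x))) := by
    intro R hR hRν hRJ π' h1 h2 hc
    refine eq_graph_of_small μ _ (measurable_mean R) π' h1 fun δ hδ => ?_
    obtain ⟨κ, hκ, hst⟩ := stability ρ hρ μ ν _ (measurable_mean R) (mean_convexOrder μ ν hν R hRν)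
      Jinf hfin hRJ.le hmin δ hδ
    exact hst π' h1 h2 (hc.trans le_self_add)
  -- the graph coupling
  have hgm : ∀ R : Kernel E E, Measurable (fun x : E => (x, ∫ y, y ∂(R x))) := fun R =>
    measurable_id.prodMk (measurable_mean R)
  have hg1 : ∀ R : Kernel E E, (μ.map (fun x : E => (x, ∫ y, y ∂(R x)))).map Prod.fst = μ := by
    intro R
    rw [Measure.map_map measurable_fst (hgm R)]
    exact Measure.map_id
  have hg2 : ∀ R : Kernel E E, (μ.map (fun x : E => (x, ∫ y, y ∂(R x)))).map Prod.snd =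
      μ.map (fun x : E => ∫ y, y ∂(R x)) := by
    intro R
    rw [Measure.map_map measurable_snd (hgm R)]
    rfl
  have hgc : ∀ R : Kernel E E, ∫⁻ p, ENNReal.ofReal (‖p.1 - p.2‖ ^ ρ)
      ∂(μ.map (fun x : E => (x, ∫ y, y ∂(R x)))) = J R := by
    intro R
    rw [lintegral_map (by fun_prop) (hgm R)]
  refine ⟨?_, ?_⟩
  · intro R₁ R₂ hR₁ hν₁ hJ₁ hR₂ hν₂ hJ₂
    have h := huniq R₁ hR₁ hν₁ hJ₁ (μ.map (fun x : E => (x, ∫ y, y ∂(R₂ x)))) (hg1 R₂)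
      (by rw [hg2]; exact mean_convexOrder μ ν hν R₂ hν₂) (by rw [hgc]; exact hJ₂.le)
    have hms : MeasurableSet {p : E × E | p.2 = ∫ y, y ∂(R₁ p.1)} :=
      measurableSet_eq_fun measurable_snd ((measurable_mean R₁).comp measurable_fst)
    have h3 : ∀ᵐ p ∂(μ.map (fun x : E => (x, ∫ y, y ∂(R₂ x)))), p.2 = ∫ y, y ∂(R₁ p.1) := by
      rw [h, ae_map_iff (hgm R₁).aemeasurable hms]
      exact Filter.Eventually.of_forall fun x => rfl
    rw [ae_map_iff (hgm R₂).aemeasurable hms] at h3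
    filter_upwards [h3] with x hx
    exact hx.symm
  · intro R hR hRν hRJ m proj π
    have hmm : Measurable m := measurable_mean R
    have hcx : ConvexOrder proj ν := mean_convexOrder μ ν hν R hRν
    have hprob : IsProbabilityMeasure proj := Measure.isProbabilityMeasure_map hmm.aemeasurable
    have hle : Wp ρ μ proj ≤ Jinf := by
      rw [← hRJ, ← hgc R]
      exact iInf_le_of_le _ (iInf_le_of_le (hg1 R) (iInf_le _ (hg2 R)))
    have hWproj : Wp ρ μ proj = Jinf := le_antisymm hle (hWp _ hcx)
    have hWJ : Winf = Jinf := le_antisymm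
      ((iInf_le_of_le proj (iInf_le_of_le hprob (iInf_le _ hcx))).trans hle) hJW
    refine ⟨⟨hcx, hWproj.trans hWJ.symm⟩, ?_, ⟨hg1 R, hg2 R, ?_⟩, ?_⟩
    · intro η hη hηcx hηW
      refine eq_proj_of_small μ η m hmm fun δ hδ => ?_
      obtain ⟨κ, hκ, hst⟩ := stability ρ hρ μ ν _ hmm hcx Jinf hfin hRJ.le hmin δ hδ
      have hlt : Wp ρ μ η < Jinf + ENNReal.ofReal κ := by
        rw [hηW, hWJ]
        exact ENNReal.lt_add_right hfin (by simpa using hκ)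
      simp only [Wp, iInf_lt_iff] at hlt
      obtain ⟨π', h1, h2, hc⟩ := hlt
      exact ⟨π', h1, h2, hst π' h1 (h2 ▸ hηcx) hc.le⟩
    · rw [hWproj, ← hRJ]; exact hgc R
    · intro π' h1 h2 hc
      exact huniq R hR hRν hRJ π' h1 (h2 ▸ hcx) (hc.trans hWproj).le
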